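/- If F₁ and F₂ are fundamental faces of H, then F₁ ∩ F₂ is a fundamental face of H, and the smallest face of H containing F₁ ∪ F₂ is a fundamental face of H. -/

import Mathlib

open Set Module

noncomputable section

/-- The linear reflection `x ↦ x - f x • a` associated to a vector `a` and a linear
functional `f` with `f a = 2`, bundled as a linear automorphism. -/
def reflEquiv {V : Type*} [AddCommGroup V] [Module ℝ V]
    (a : V) (f : V →ₗ[ℝ] ℝ) (h2 : f a = 2) : V ≃ₗ[ℝ] V :=
  LinearEquiv.ofInvolutive (LinearMap.id - f.smulRight a)
    (fun x => by
      simp only [LinearMap.sub_apply, LinearMap.id_apply, LinearMap.smulRight_apply,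
        map_sub, map_smul, smul_eq_mul, h2]
      module)

/-- A realization over `ℝ` of an `m × m` generalized Cartan matrix `A`:
simple roots `α_i`, simple coroots `α_i∨` (as linear functionals), with
`⟨α_j, α_i∨⟩ = a_{ij}`, together with the defining axioms. -/
structure GCMRealization (m : ℕ) (V : Type*) [NormedAddCommGroup V] [NormedSpace ℝ V] where
  A : Matrix (Fin m) (Fin m) ℤ
  root : Fin m → V
  coroot : Fin m → V →ₗ[ℝ] ℝ
  one_le_m : 1 ≤ m
  A_diag : ∀ i, A i i = 2
  A_offdiag : ∀ i j, i ≠ j → A i j ≤ 0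
  A_zero_iff : ∀ i j, A i j = 0 ↔ A j i = 0
  root_indep : LinearIndependent ℝ root
  coroot_indep : LinearIndependent ℝ coroot
  pairing : ∀ i j, coroot i (root j) = (A i j : ℝ)
  finDim : FiniteDimensional ℝ V
  dim_eq : finrank ℝ V + (A.map ((↑) : ℤ → ℝ)).rank = 2 * m

/-- A face of a convex set `H`: a convex subset `F ⊆ H` such that whenever the open
segment between two points of `H` meets `F`, both points lie in `F`. -/
def IsFaceOf {V : Type*} [NormedAddCommGroup V] [NormedSpace ℝ V] (H F : Set V) : Prop :=
  Convex ℝ F ∧ IsExtreme ℝ H F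

namespace GCMRealization

variable {m : ℕ} {V : Type*} [NormedAddCommGroup V] [NormedSpace ℝ V]
variable (S : GCMRealization m V)

/-- The fundamental reflection `r_i`. -/
def s (i : Fin m) : V ≃ₗ[ℝ] V :=
  reflEquiv (S.root i) (S.coroot i) (by
    have h := S.pairing i i
    rw [S.A_diag i] at h
    simpa using h)

/-- The Weyl group `W`, as a subgroup of the group of linear automorphisms of `V`. -/
def W : Subgroup (V ≃ₗ[ℝ] V) := Subgroup.closure (Set.range S.s)

/-- The standard parabolic subgroup `W_I` generated by the reflections indexed by `I`. -/
def WI (I : Set (Fin m)) : Subgroup (V ≃ₗ[ℝ] V) := Subgroup.closure (S.s '' I)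

/-- The closed fundamental chamber `C̄`. -/
def chamber : Set V := {η | ∀ i, 0 ≤ S.coroot i η}

/-- `J₀`: the set of indices `i` with `⟨μ, α_i∨⟩ = 0`. -/
def J0 (μ : V) : Set (Fin m) := {i | S.coroot i μ = 0}

/-- The orbit of `μ` under a subgroup of linear automorphisms. -/
def orbitOf (G : Subgroup (V ≃ₗ[ℝ] V)) (μ : V) : Set V :=
  (fun w : V ≃ₗ[ℝ] V => w μ) '' (G : Set (V ≃ₗ[ℝ] V))

/-- `F_I`: the convex hull of `W_I · μ`. -/
def face (μ : V) (I : Set (Fin m)) : Set V := convexHull ℝ (orbitOf (S.WI I) μ)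

/-- `H`: the convex hull of the Weyl group orbit of `μ`. -/
def orbitHull (μ : V) : Set V := convexHull ℝ (orbitOf S.W μ)

/-- `ℝ₊I`: the set of nonnegative linear combinations of the simple roots indexed by `I`. -/
def coneNonneg (I : Set (Fin m)) : Set V :=
  {v | ∃ c : Fin m → ℝ, (∀ i, 0 ≤ c i) ∧ (∀ i, i ∉ I → c i = 0) ∧ v = ∑ i, c i • S.root i}

/-- `ℝ_>I`: the set of strictly positive linear combinations of the simple roots indexed
by `I` (with `ℝ_>∅ = {0}`). -/
def conePos (I : Set (Fin m)) : Set V :=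
  {v | ∃ c : Fin m → ℝ, (∀ i ∈ I, 0 < c i) ∧ (∀ i, i ∉ I → c i = 0) ∧ v = ∑ i, c i • S.root i}

/-- The open standard facet `C_J`. -/
def openFacet (J : Set (Fin m)) : Set V :=
  {η | (∀ i ∈ J, S.coroot i η = 0) ∧ ∀ i, i ∉ J → 0 < S.coroot i η}

/-- The closed standard facet `C̄_J`. -/
def closedFacet (J : Set (Fin m)) : Set V :=
  {η | (∀ i ∈ J, S.coroot i η = 0) ∧ ∀ i, i ∉ J → 0 ≤ S.coroot i η}

/-- Adjacency of two vertices of the Dynkin diagram: `i ≠ j` and `a_{ij} ≠ 0`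
(equivalently `a_{ji} ≠ 0`). -/
def Adjacent (i j : Fin m) : Prop := i ≠ j ∧ S.A i j ≠ 0 ∧ S.A j i ≠ 0

/-- The Dynkin diagram, as a simple graph on the index set. -/
def diagram : SimpleGraph (Fin m) where
  Adj := S.Adjacent
  symm := ⟨fun _ _ h => ⟨h.1.symm, h.2.2, h.2.1⟩⟩
  loopless := ⟨fun _ h => h.1 rfl⟩

/-- A subset `I` is `μ`-connected if every connected component of `I` meets
`J_> = Π \ J₀` (the empty set is `μ`-connected). -/
def MuConnected (μ : V) (I : Set (Fin m)) : Prop :=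
  ∀ i : I, ∃ j : I, S.coroot (j : Fin m) μ ≠ 0 ∧ (S.diagram.induce I).Reachable i j

/-- The connected component of `i` inside `K`, as a subset of the index set. -/
def comp (K : Set (Fin m)) (i : Fin m) : Set (Fin m) :=
  {j | ∃ (hi : i ∈ K) (hj : j ∈ K), (S.diagram.induce K).Reachable ⟨i, hi⟩ ⟨j, hj⟩}

/-- `I*`: the largest `μ`-connected subset of `I`, i.e. the union of the connected
components of `I` that meet `J_>`. -/
def muPart (μ : V) (I : Set (Fin m)) : Set (Fin m) :=
  {j | ∃ (hj : j ∈ I) (k : Fin m) (hk : k ∈ I), S.coroot k μ ≠ 0 ∧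
    (S.diagram.induce I).Reachable ⟨j, hj⟩ ⟨k, hk⟩}

/-- `I_*`: the set of `α ∈ J₀ \ I` orthogonal to all of `I`. -/
def starSet (μ : V) (I : Set (Fin m)) : Set (Fin m) :=
  {i | S.coroot i μ = 0 ∧ i ∉ I ∧ ∀ j ∈ I, S.coroot i (S.root j) = 0}

/-- A subset `K ⊆ Π` is of finite type if the subgroup `W_K` is finite. -/
def FiniteType (K : Set (Fin m)) : Prop := ((S.WI K : Subgroup (V ≃ₗ[ℝ] V)) : Set (V ≃ₗ[ℝ] V)).Finite

/-- Every connected component of `K` is of finite type. -/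
def FinTypeComponents (K : Set (Fin m)) : Prop := ∀ i ∈ K, S.FiniteType (S.comp K i)

/-- A fundamental face of `H`: a face which is empty or whose relative interior meets
the fundamental chamber. -/
def IsFundFace (μ : V) (F : Set V) : Prop :=
  IsFaceOf (S.orbitHull μ) F ∧ (F = ∅ ∨ (intrinsicInterior ℝ F ∩ S.chamber).Nonempty)

/-- The length of `w ∈ W` with respect to the fundamental reflections. -/
def len (w : V ≃ₗ[ℝ] V) : ℕ :=
  sInf {k | ∃ l : List (Fin m), l.length = k ∧ w = (l.map S.s).prod}

end GCMRealization

end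

namespace Stmt19

/-! ### Convex geometry -/

section Convexity

variable {V : Type*} [NormedAddCommGroup V] [NormedSpace ℝ V]

lemma mem_ri_iff {F : Set V} {x : V} :
    x ∈ intrinsicInterior ℝ F ↔ x ∈ affineSpan ℝ F ∧
      ∃ δ > 0, ∀ y ∈ affineSpan ℝ F, dist y x < δ → y ∈ F := by
  rw [mem_intrinsicInterior]
  constructor
  · rintro ⟨y, hy, rfl⟩
    refine ⟨y.2, ?_⟩
    rw [mem_interior_iff_mem_nhds, Metric.mem_nhds_iff] at hy
    obtain ⟨δ, hδ, h⟩ := hy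
    refine ⟨δ, hδ, fun z hz hd => ?_⟩
    exact h (show (⟨z, hz⟩ : affineSpan ℝ F) ∈ Metric.ball y δ from hd)
  · rintro ⟨hx, δ, hδ, h⟩
    refine ⟨⟨x, hx⟩, ?_, rfl⟩
    rw [mem_interior_iff_mem_nhds, Metric.mem_nhds_iff]
    exact ⟨δ, hδ, fun z hz => h z z.2 hz⟩

lemma combo_mem_span {F : Set V} {x y : V} (hx : x ∈ affineSpan ℝ F) (hy : y ∈ affineSpan ℝ F)
    (t : ℝ) : x + t • (x - y) ∈ affineSpan ℝ F := by
  have h := AffineMap.lineMap_mem (-t) hx hy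
  rw [AffineMap.lineMap_apply] at h
  convert h using 1
  simp only [vsub_eq_sub, vadd_eq_add]
  module

lemma trans_mem_span {F : Set V} {x y p : V} (hx : x ∈ affineSpan ℝ F)
    (hy : y ∈ affineSpan ℝ F) (hp : p ∈ affineSpan ℝ F)
    (t : ℝ) : p + t • (x - y) ∈ affineSpan ℝ F := by
  have h := AffineSubspace.smul_vsub_vadd_mem _ t hx hy hp
  rw [vsub_eq_sub, vadd_eq_add, add_comm] at h
  exact h

lemma ri_extend {F : Set V} {x y : V} (hx : x ∈ intrinsicInterior ℝ F) (hy : y ∈ F) :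
    ∃ ε : ℝ, 0 < ε ∧ x + ε • (x - y) ∈ F := by
  obtain ⟨hxs, δ, hδ, h⟩ := mem_ri_iff.1 hx
  have hys : y ∈ affineSpan ℝ F := subset_affineSpan ℝ F hy
  refine ⟨δ / (2 * (‖x - y‖ + 1)), by positivity, ?_⟩
  apply h _ (combo_mem_span hxs hys _)
  rw [dist_eq_norm, add_sub_cancel_left, norm_smul, Real.norm_eq_abs,
    abs_of_pos (by positivity)]
  have := norm_nonneg (x - y)
  rw [div_mul_eq_mul_div, div_lt_iff₀ (by positivity)]
  nlinarith

lemma ri_of_combo {F : Set V} (hF : Convex ℝ F) {p q : V} (hp : p ∈ intrinsicInterior ℝ F)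
    (hq : q ∈ F) {a b : ℝ} (ha : 0 < a) (hb : 0 ≤ b) (hab : a + b = 1) :
    a • p + b • q ∈ intrinsicInterior ℝ F := by
  obtain ⟨hps, δ, hδ, h⟩ := mem_ri_iff.1 hp
  have hpF : p ∈ F := intrinsicInterior_subset hp
  have hz : a • p + b • q ∈ affineSpan ℝ F := subset_affineSpan ℝ F (hF hpF hq ha.le hb hab)
  refine mem_ri_iff.2 ⟨hz, a * δ, by positivity, fun y hy hd => ?_⟩
  have h1 : p + a⁻¹ • (y - (a • p + b • q)) ∈ F := by
    apply h _ (trans_mem_span hy hz hps _)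
    rw [dist_eq_norm, add_sub_cancel_left, norm_smul, Real.norm_eq_abs,
      abs_of_pos (by positivity)]
    rw [dist_eq_norm] at hd
    rw [inv_mul_lt_iff₀ ha]
    exact hd
  have h2 := hF h1 hq ha.le hb hab
  convert h2 using 1
  rw [smul_add, smul_smul, mul_inv_cancel₀ ha.ne']
  module

lemma face_mem_left {H F : Set V} (hF : IsFaceOf H F) {x y : V} {ε : ℝ} (hε : 0 < ε)
    (hx : x ∈ F) (hy : y ∈ H) (hz : x + ε • (x - y) ∈ H) : y ∈ F := by
  refine hF.2.left_mem_of_mem_openSegment hy hz hx ?_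
  refine ⟨ε / (1 + ε), 1 / (1 + ε), by positivity, by positivity, by field_simp; ring, ?_⟩
  have hD : (1 + ε) ≠ 0 := by positivity
  apply smul_right_injective V hD
  simp only
  rw [smul_add, smul_smul, smul_smul, mul_div_cancel₀ _ hD, mul_div_cancel₀ _ hD]
  module

lemma face_contains {H F G : Set V} (hF : F ⊆ H) (hG : IsFaceOf H G) {x : V}
    (hx : x ∈ intrinsicInterior ℝ F) (hxG : x ∈ G) : F ⊆ G := by
  intro y hy
  obtain ⟨ε, hε, h⟩ := ri_extend hx hy
  exact face_mem_left hG hε hxG (hF hy) (hF h)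

/-- the face generated by a point -/
def genFace (H : Set V) (z : V) : Set V := {y | y ∈ H ∧ ∃ ε : ℝ, 0 < ε ∧ z + ε • (z - y) ∈ H}

lemma shrink {H : Set V} (hH : Convex ℝ H) {z y : V} (hz : z ∈ H) {ε δ : ℝ}
    (hδ : 0 < δ) (hδε : δ ≤ ε) (h : z + ε • (z - y) ∈ H) : z + δ • (z - y) ∈ H := by
  have hε : 0 < ε := hδ.trans_le hδε
  have h2 := hH hz h (a := 1 - δ / ε) (b := δ / ε)
    (by rw [sub_nonneg, div_le_one hε]; exact hδε) (by positivity) (by ring)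
  convert h2 using 1
  have : δ = δ / ε * ε := by field_simp
  rw [smul_add, smul_smul, ← this]
  module

lemma genFace_isFace {H : Set V} (hH : Convex ℝ H) {z : V} (hz : z ∈ H) :
    IsFaceOf H (genFace H z) := by
  refine ⟨?_, ⟨fun y hy => hy.1, ?_⟩⟩
  · rintro u ⟨hu, e1, he1, h1⟩ v ⟨hv, e2, he2, h2⟩ a b ha hb hab
    refine ⟨hH hu hv ha hb hab, min e1 e2, lt_min he1 he2, ?_⟩
    have h1' := shrink hH hz (lt_min he1 he2) (min_le_left _ _) h1
    have h2' := shrink hH hz (lt_min he1 he2) (min_le_right _ _) h2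
    convert hH h1' h2' ha hb hab using 1
    have : b = 1 - a := by linarith
    subst this
    module
  · rintro u hu v hv y ⟨hy, e, he, h⟩ ⟨a, b, ha, hb, hab, rfl⟩
    refine ⟨hu, e * a / (1 + e * b), by positivity, ?_⟩
    have h2 := hH h hv (a := 1 / (1 + e * b)) (b := e * b / (1 + e * b)) (by positivity)
      (by positivity) (by field_simp)
    convert h2 using 1
    have hb' : b = 1 - a := by linarith
    subst hb'
    have hD : (1 + e * (1 - a)) ≠ 0 := by positivity
    have key : (1 + e * (1 - a)) • (z + (e * a / (1 + e * (1 - a))) • (z - u)) =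
      (1 + e * (1 - a)) • ((1 / (1 + e * (1 - a))) • (z + e • (z - (a • u + (1 - a) • v))) +
        (e * (1 - a) / (1 + e * (1 - a))) • v) := by
      rw [smul_add, smul_add, smul_smul, smul_smul, smul_smul, mul_div_cancel₀ _ hD,
        mul_div_cancel₀ _ hD, mul_div_cancel₀ _ hD]
      module
    exact smul_right_injective _ hD key

lemma self_mem_genFace {H : Set V} {z : V} (hz : z ∈ H) : z ∈ genFace H z :=
  ⟨hz, 1, one_pos, by simpa using hz⟩

lemma genFace_ri [FiniteDimensional ℝ V] {H : Set V} (hH : Convex ℝ H) {z : V} (hz : z ∈ H) :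
    z ∈ intrinsicInterior ℝ (genFace H z) := by
  have hF := genFace_isFace hH hz
  obtain ⟨p, hp⟩ := Set.Nonempty.intrinsicInterior hF.1 ⟨z, self_mem_genFace hz⟩
  obtain ⟨hpH, e, he, h⟩ := intrinsicInterior_subset hp
  have hq : z + e • (z - p) ∈ genFace H z := by
    refine ⟨h, e⁻¹, by positivity, ?_⟩
    convert hpH using 1
    rw [sub_add_cancel_left, smul_neg, smul_smul, inv_mul_cancel₀ he.ne']
    module
  have := ri_of_combo hF.1 hp hq (a := e / (1 + e)) (b := 1 / (1 + e)) (by positivity)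
    (by positivity) (by field_simp; ring)
  convert this using 1
  have hD : (1 + e) ≠ 0 := by positivity
  apply smul_right_injective V hD
  simp only
  rw [smul_add, smul_smul, smul_smul, mul_div_cancel₀ _ hD, mul_div_cancel₀ _ hD]
  module

lemma genFace_least {H F : Set V} {z : V} (hF : IsFaceOf H F) (hz : z ∈ F) :
    genFace H z ⊆ F := by
  rintro y ⟨hy, e, he, h⟩
  exact face_mem_left hF he hz hy h

lemma inter_face {H F G : Set V} (hF : IsFaceOf H F) (hG : IsFaceOf H G) :
    IsFaceOf H (F ∩ G) := ⟨hF.1.inter hG.1, hF.2.inter hG.2⟩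

lemma ri_of_image_subset [FiniteDimensional ℝ V] {G : Set V} (w : V ≃ₗ[ℝ] V)
    (hw : w '' G ⊆ G) {y : V} (hy : y ∈ intrinsicInterior ℝ G) :
    w y ∈ intrinsicInterior ℝ G := by
  have h1 : w y ∈ intrinsicInterior ℝ (w '' G) := by
    have := AffineEquiv.intrinsicInterior_image w.toAffineEquiv G
    have h2 : w y ∈ w.toAffineEquiv '' intrinsicInterior ℝ G := ⟨y, hy, rfl⟩
    rw [← this] at h2
    exact h2
  have hspan : affineSpan ℝ (w '' G) = affineSpan ℝ G := by
    have hle : affineSpan ℝ (w '' G) ≤ affineSpan ℝ G := affineSpan_mono ℝ hw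
    have hne : ((affineSpan ℝ (w '' G) : AffineSubspace ℝ V) : Set V).Nonempty :=
      ⟨w y, subset_affineSpan ℝ _ ⟨y, intrinsicInterior_subset hy, rfl⟩⟩
    refine AffineSubspace.eq_of_direction_eq_of_nonempty_of_le ?_ hne hle
    apply Submodule.eq_of_le_of_finrank_eq (AffineSubspace.direction_le hle)
    have : affineSpan ℝ (w '' G) =
        (affineSpan ℝ G).map (w.toAffineEquiv : V →ᵃ[ℝ] V) := by
      rw [AffineSubspace.map_span]; rfl
    rw [this, AffineSubspace.map_direction]
    exact LinearEquiv.finrank_map_eq w _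
  obtain ⟨hs, δ, hδ, h⟩ := mem_ri_iff.1 h1
  refine mem_ri_iff.2 ⟨hspan ▸ hs, δ, hδ, fun z hz hd => hw (h z (hspan ▸ hz) hd)⟩

end Convexity

/-! ### Descending paths -/

section Paths

variable {m : ℕ} {V : Type*} [NormedAddCommGroup V] [NormedSpace ℝ V]
variable (S : GCMRealization m V)

lemma s_apply (i : Fin m) (v : V) : S.s i v = v - S.coroot i v • S.root i := rfl

lemma pair_self (i : Fin m) : S.coroot i (S.root i) = 2 := by
  rw [S.pairing, S.A_diag]; norm_num

lemma coroot_s (i : Fin m) (v : V) : S.coroot i (S.s i v) = - S.coroot i v := by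
  rw [s_apply, map_sub, map_smul, pair_self, smul_eq_mul]; ring

lemma s_s (i : Fin m) (v : V) : S.s i (S.s i v) = v := by
  rw [s_apply S i (S.s i v), coroot_s, s_apply]; module

/-- `Desc S I η₀ k η`: `η` is reached from `η₀` by `k` weakly descending simple reflections
indexed by `I`. -/
inductive Desc (I : Set (Fin m)) (η₀ : V) : ℕ → V → Prop
  | base : Desc I η₀ 0 η₀
  | step {k : ℕ} {η : V} (i : Fin m) (hi : i ∈ I) (h : Desc I η₀ k η)
      (hp : 0 ≤ S.coroot i η) : Desc I η₀ (k + 1) (S.s i η)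

lemma Desc.append {I : Set (Fin m)} {η₀ η₁ η₂ : V} {k l : ℕ} (h : Desc S Set.univ η₀ k η₁)
    (h' : Desc S I η₁ l η₂) : Desc S Set.univ η₀ (k + l) η₂ := by
  induction h' with
  | base => exact h
  | step i _ _ hp ih => exact Desc.step i (Set.mem_univ i) ih hp

/-- The conclusion of the rank two analysis. -/
def Rank2 (i j : Fin m) : Prop :=
  ∀ (η₀ : V), 0 ≤ S.coroot i η₀ → 0 ≤ S.coroot j η₀ → ∀ (k : ℕ) (η : V),
    Desc S {i, j} η₀ k η → ∀ l ∈ ({i, j} : Set (Fin m)), S.coroot l η < 0 →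
      ∃ k' < k, Desc S {i, j} η₀ k' (S.s l η)

lemma Rank2.symm {i j : Fin m} (h : Rank2 S i j) : Rank2 S j i := by
  intro η₀ h1 h2
  rw [Set.pair_comm j i]
  exact h η₀ h2 h1

lemma rank2_of_table {i j : Fin m} (a b : ℝ) (hij : S.coroot i (S.root j) = -a)
    (hji : S.coroot j (S.root i) = -b)
    (R : ℝ → ℝ → ℕ → ℝ → ℝ → Prop)
    (hR0 : ∀ x y c d, R x y 0 c d ↔ c = 0 ∧ d = 0)
    (hRi : ∀ x y, 0 ≤ x → 0 ≤ y → ∀ k c d, R x y k c d →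
      (0 ≤ x - 2 * c + a * d ∧ R x y (k + 1) (x - c + a * d) d) ∨
      (x - 2 * c + a * d ≤ 0 ∧ ∃ k', k = k' + 1 ∧ R x y k' (x - c + a * d) d))
    (hRj : ∀ x y, 0 ≤ x → 0 ≤ y → ∀ k c d, R x y k c d →
      (0 ≤ y - 2 * d + b * c ∧ R x y (k + 1) c (y - d + b * c)) ∨
      (y - 2 * d + b * c ≤ 0 ∧ ∃ k', k = k' + 1 ∧ R x y k' c (y - d + b * c)))
    (hU : ∀ x y, 0 ≤ x → 0 ≤ y → ∀ k c d, R x y (k + 1) c d →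
      (x - 2 * c + a * d ≤ 0 ∧ R x y k (x - c + a * d) d) ∨
      (y - 2 * d + b * c ≤ 0 ∧ R x y k c (y - d + b * c))) :
    Rank2 S i j := by
  intro η₀ hx hy
  set x := S.coroot i η₀ with hxd
  set y := S.coroot j η₀ with hyd
  have fi : ∀ c d : ℝ, S.coroot i (η₀ - c • S.root i - d • S.root j) = x - 2 * c + a * d := by
    intro c d
    rw [map_sub, map_sub, map_smul, map_smul, pair_self, hij, ← hxd, smul_eq_mul, smul_eq_mul]
    ring
  have fj : ∀ c d : ℝ, S.coroot j (η₀ - c • S.root i - d • S.root j) = y - 2 * d + b * c := by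
    intro c d
    rw [map_sub, map_sub, map_smul, map_smul, pair_self, hji, ← hyd, smul_eq_mul, smul_eq_mul]
    ring
  have si : ∀ c d : ℝ, S.s i (η₀ - c • S.root i - d • S.root j) =
      η₀ - (x - c + a * d) • S.root i - d • S.root j := by
    intro c d
    rw [s_apply, fi]; module
  have sj : ∀ c d : ℝ, S.s j (η₀ - c • S.root i - d • S.root j) =
      η₀ - c • S.root i - (y - d + b * c) • S.root j := by
    intro c d
    rw [s_apply, fj]; module
  have hii : i ∈ ({i, j} : Set (Fin m)) := by simp
  have hjj : j ∈ ({i, j} : Set (Fin m)) := by simp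
  -- table entries are reached
  have key3 : ∀ k c d, R x y k c d →
      Desc S {i, j} η₀ k (η₀ - c • S.root i - d • S.root j) := by
    intro k
    induction k with
    | zero =>
      intro c d h
      obtain ⟨rfl, rfl⟩ := (hR0 x y c d).1 h
      simpa using Desc.base
    | succ k ih =>
      intro c d h
      rcases hU x y hx hy k c d h with ⟨h1, h2⟩ | ⟨h1, h2⟩
      · have h3 := ih _ _ h2
        have h4 := Desc.step i hii h3 (by rw [fi]; linarith)
        rw [si] at h4
        convert h4 using 4
        ring
      · have h3 := ih _ _ h2
        have h4 := Desc.step j hjj h3 (by rw [fj]; linarith)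
        rw [sj] at h4
        convert h4 using 3
        ring
  -- everything reached is in the table
  have key2 : ∀ k η, Desc S {i, j} η₀ k η →
      ∃ k' ≤ k, ∃ c d, R x y k' c d ∧ η = η₀ - c • S.root i - d • S.root j := by
    intro k η h
    induction h with
    | base => exact ⟨0, le_rfl, 0, 0, (hR0 x y 0 0).2 ⟨rfl, rfl⟩, by simp⟩
    | step l hl h hp ih =>
      obtain ⟨k', hk', c, d, hR, rfl⟩ := ih
      rcases hl with rfl | hl
      · rw [fi] at hp
        rcases hRi x y hx hy k' c d hR with ⟨h1, h2⟩ | ⟨h1, -⟩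
        · exact ⟨k' + 1, by omega, _, _, h2, si c d⟩
        · refine ⟨k', by omega, c, d, hR, ?_⟩
          have : x - 2 * c + a * d = 0 := le_antisymm h1 hp
          rw [s_apply, fi, this]; simp
      · obtain rfl : l = j := hl
        rw [fj] at hp
        rcases hRj x y hx hy k' c d hR with ⟨h1, h2⟩ | ⟨h1, -⟩
        · exact ⟨k' + 1, by omega, _, _, h2, sj c d⟩
        · refine ⟨k', by omega, c, d, hR, ?_⟩
          have : y - 2 * d + b * c = 0 := le_antisymm h1 hp
          rw [s_apply, fj, this]; simp
  intro k η h l hl hneg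
  obtain ⟨k', hk', c, d, hR, rfl⟩ := key2 k η h
  rcases hl with rfl | hl
  · rw [fi] at hneg
    rcases hRi x y hx hy k' c d hR with ⟨h1, h2⟩ | ⟨h1, k'', rfl, h2⟩
    · linarith
    · refine ⟨k'', by omega, ?_⟩
      rw [si]
      exact key3 _ _ _ h2
  · obtain rfl : l = j := hl
    rw [fj] at hneg
    rcases hRj x y hx hy k' c d hR with ⟨h1, h2⟩ | ⟨h1, k'', rfl, h2⟩
    · linarith
    · refine ⟨k'', by omega, ?_⟩
      rw [sj]
      exact key3 _ _ _ h2

def tab0 (x y : ℝ) (k : ℕ) (c d : ℝ) : Prop :=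
  match k with
  | 0 => c = 0 ∧ d = 0
  | 1 => (c = x ∧ d = 0) ∨ (c = 0 ∧ d = y)
  | 2 => c = x ∧ d = y
  | _ => False

def tab1 (x y : ℝ) (k : ℕ) (c d : ℝ) : Prop :=
  match k with
  | 0 => c = 0 ∧ d = 0
  | 1 => (c = x ∧ d = 0) ∨ (c = 0 ∧ d = y)
  | 2 => (c = x ∧ d = x + y) ∨ (c = x + y ∧ d = y)
  | 3 => c = x + y ∧ d = x + y
  | _ => False

def tab2 (x y : ℝ) (k : ℕ) (c d : ℝ) : Prop :=
  match k with
  | 0 => c = 0 ∧ d = 0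
  | 1 => (c = x ∧ d = 0) ∨ (c = 0 ∧ d = y)
  | 2 => (c = x ∧ d = 2 * x + y) ∨ (c = x + y ∧ d = y)
  | 3 => (c = 2 * x + y ∧ d = 2 * x + y) ∨ (c = x + y ∧ d = 2 * x + 2 * y)
  | 4 => c = 2 * x + y ∧ d = 2 * x + 2 * y
  | _ => False

def tab3 (x y : ℝ) (k : ℕ) (c d : ℝ) : Prop :=
  match k with
  | 0 => c = 0 ∧ d = 0
  | 1 => (c = x ∧ d = 0) ∨ (c = 0 ∧ d = y)
  | 2 => (c = x ∧ d = 3 * x + y) ∨ (c = x + y ∧ d = y)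
  | 3 => (c = 3 * x + y ∧ d = 3 * x + y) ∨ (c = x + y ∧ d = 3 * x + 3 * y)
  | 4 => (c = 3 * x + y ∧ d = 6 * x + 3 * y) ∨ (c = 3 * x + 2 * y ∧ d = 3 * x + 3 * y)
  | 5 => (c = 4 * x + 2 * y ∧ d = 6 * x + 3 * y) ∨ (c = 3 * x + 2 * y ∧ d = 6 * x + 4 * y)
  | 6 => c = 4 * x + 2 * y ∧ d = 6 * x + 4 * y
  | _ => False

lemma rank2_0 {i j : Fin m} (hij : S.coroot i (S.root j) = -0)
    (hji : S.coroot j (S.root i) = -0) : Rank2 S i j := by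
  refine rank2_of_table S 0 0 hij hji tab0 (fun _ _ _ _ => Iff.rfl) ?_ ?_ ?_
  all_goals
    intro x y hx hy k c d h
    rcases k with _ | _ | _ | k
    all_goals simp only [tab0, zero_add, Nat.reduceAdd] at h ⊢
    all_goals try rcases h with ⟨rfl, rfl⟩ | ⟨rfl, rfl⟩
    all_goals try obtain ⟨rfl, rfl⟩ := h
    all_goals first
    | exact h.elim
    | (left; refine ⟨by linarith, ?_⟩; first | (constructor <;> linarith) | (left; constructor <;> linarith) | (right; constructor <;> linarith))
    | (right; refine ⟨by linarith, ?_⟩; first | (constructor <;> linarith) | (left; constructor <;> linarith) | (right; constructor <;> linarith))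
    | (right; refine ⟨by linarith, _, rfl, ?_⟩; first | (constructor <;> linarith) | (left; constructor <;> linarith) | (right; constructor <;> linarith))

lemma rank2_1 {i j : Fin m} (hij : S.coroot i (S.root j) = -1)
    (hji : S.coroot j (S.root i) = -1) : Rank2 S i j := by
  refine rank2_of_table S 1 1 hij hji tab1 (fun _ _ _ _ => Iff.rfl) ?_ ?_ ?_
  all_goals
    intro x y hx hy k c d h
    rcases k with _ | _ | _ | _ | k
    all_goals simp only [tab1, zero_add, Nat.reduceAdd] at h ⊢
    all_goals try rcases h with ⟨rfl, rfl⟩ | ⟨rfl, rfl⟩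
    all_goals try obtain ⟨rfl, rfl⟩ := h
    all_goals first
    | exact h.elim
    | (left; refine ⟨by linarith, ?_⟩; first | (constructor <;> linarith) | (left; constructor <;> linarith) | (right; constructor <;> linarith))
    | (right; refine ⟨by linarith, ?_⟩; first | (constructor <;> linarith) | (left; constructor <;> linarith) | (right; constructor <;> linarith))
    | (right; refine ⟨by linarith, _, rfl, ?_⟩; first | (constructor <;> linarith) | (left; constructor <;> linarith) | (right; constructor <;> linarith))

lemma rank2_2 {i j : Fin m} (hij : S.coroot i (S.root j) = -1)
    (hji : S.coroot j (S.root i) = -2) : Rank2 S i j := by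
  refine rank2_of_table S 1 2 hij hji tab2 (fun _ _ _ _ => Iff.rfl) ?_ ?_ ?_
  all_goals
    intro x y hx hy k c d h
    rcases k with _ | _ | _ | _ | _ | k
    all_goals simp only [tab2, zero_add, Nat.reduceAdd] at h ⊢
    all_goals try rcases h with ⟨rfl, rfl⟩ | ⟨rfl, rfl⟩
    all_goals try obtain ⟨rfl, rfl⟩ := h
    all_goals first
    | exact h.elim
    | (left; refine ⟨by linarith, ?_⟩; first | (constructor <;> linarith) | (left; constructor <;> linarith) | (right; constructor <;> linarith))
    | (right; refine ⟨by linarith, ?_⟩; first | (constructor <;> linarith) | (left; constructor <;> linarith) | (right; constructor <;> linarith))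
    | (right; refine ⟨by linarith, _, rfl, ?_⟩; first | (constructor <;> linarith) | (left; constructor <;> linarith) | (right; constructor <;> linarith))

lemma rank2_3 {i j : Fin m} (hij : S.coroot i (S.root j) = -1)
    (hji : S.coroot j (S.root i) = -3) : Rank2 S i j := by
  refine rank2_of_table S 1 3 hij hji tab3 (fun _ _ _ _ => Iff.rfl) ?_ ?_ ?_
  all_goals
    intro x y hx hy k c d h
    rcases k with _ | _ | _ | _ | _ | _ | _ | k
    all_goals simp only [tab3, zero_add, Nat.reduceAdd] at h ⊢
    all_goals try rcases h with ⟨rfl, rfl⟩ | ⟨rfl, rfl⟩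
    all_goals try obtain ⟨rfl, rfl⟩ := h
    all_goals first
    | exact h.elim
    | (left; refine ⟨by linarith, ?_⟩; first | (constructor <;> linarith) | (left; constructor <;> linarith) | (right; constructor <;> linarith))
    | (right; refine ⟨by linarith, ?_⟩; first | (constructor <;> linarith) | (left; constructor <;> linarith) | (right; constructor <;> linarith))
    | (right; refine ⟨by linarith, _, rfl, ?_⟩; first | (constructor <;> linarith) | (left; constructor <;> linarith) | (right; constructor <;> linarith))

lemma rank2_4 {i j : Fin m} (a b : ℝ) (ha : 0 < a) (hb : 0 < b) (hab : 4 ≤ a * b)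
    (hij : S.coroot i (S.root j) = -a)
    (hji : S.coroot j (S.root i) = -b) : Rank2 S i j := by
  intro η₀ hx hy
  have hii : i ∈ ({i, j} : Set (Fin m)) := by simp
  have hjj : j ∈ ({i, j} : Set (Fin m)) := by simp
  have sij : ∀ η, S.coroot j (S.s i η) = S.coroot j η + b * S.coroot i η := by
    intro η
    rw [s_apply, map_sub, map_smul, hji, smul_eq_mul]; ring
  have sji : ∀ η, S.coroot i (S.s j η) = S.coroot i η + a * S.coroot j η := by
    intro η
    rw [s_apply, map_sub, map_smul, hij, smul_eq_mul]; ring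
  have key : ∀ k η, Desc S {i, j} η₀ k η →
      (0 ≤ S.coroot i η ∧ 0 ≤ S.coroot j η) ∨
      (S.coroot i η ≤ 0 ∧ -2 * S.coroot i η ≤ a * S.coroot j η ∧
        ∃ k' < k, Desc S {i, j} η₀ k' (S.s i η)) ∨
      (S.coroot j η ≤ 0 ∧ -2 * S.coroot j η ≤ b * S.coroot i η ∧
        ∃ k' < k, Desc S {i, j} η₀ k' (S.s j η)) := by
    intro k η h
    induction h with
    | base => exact Or.inl ⟨hx, hy⟩
    | @step k η l hl h hp ih =>
      rcases hl with rfl | hl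
      · right; left
        refine ⟨by rw [coroot_s]; linarith, ?_, k, by omega, by rw [s_s]; exact h⟩
        rw [coroot_s, sij]
        rcases ih with ⟨h1, h2⟩ | ⟨h1, h2, -⟩ | ⟨h1, h2, -⟩
        · nlinarith
        · have h0 : S.coroot l η = 0 := le_antisymm h1 hp
          rw [h0] at h2 ⊢
          linarith
        · nlinarith
      · obtain rfl : l = j := hl
        right; right
        refine ⟨by rw [coroot_s]; linarith, ?_, k, by omega, by rw [s_s]; exact h⟩
        rw [coroot_s, sji]
        rcases ih with ⟨h1, h2⟩ | ⟨h1, h2, -⟩ | ⟨h1, h2, -⟩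
        · nlinarith
        · nlinarith
        · have h0 : S.coroot l η = 0 := le_antisymm h1 hp
          rw [h0] at h2 ⊢
          linarith
  intro k η h l hl hneg
  rcases hl with rfl | hl
  · rcases key k η h with ⟨h1, h2⟩ | ⟨-, -, h3⟩ | ⟨h1, h2, -⟩
    · linarith
    · exact h3
    · nlinarith
  · obtain rfl : l = j := hl
    rcases key k η h with ⟨h1, h2⟩ | ⟨h1, h2, -⟩ | ⟨-, -, h3⟩
    · linarith
    · nlinarith
    · exact h3

lemma rank2 {i j : Fin m} (hne : i ≠ j) : Rank2 S i j := by
  have h1 := S.A_offdiag i j hne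
  have h2 := S.A_offdiag j i hne.symm
  have h3 := S.A_zero_iff i j
  have p1 := S.pairing i j
  have p2 := S.pairing j i
  generalize S.A i j = A1 at *
  generalize S.A j i = A2 at *
  by_cases h4 : 4 ≤ A1 * A2
  · have hA1 : A1 < 0 := by
      rcases h1.lt_or_eq with h | h
      · exact h
      · simp [h] at h4
    have hA2 : A2 < 0 := by
      rcases h2.lt_or_eq with h | h
      · exact h
      · simp [h] at h4
    refine rank2_4 S (-A1) (-A2) ?_ ?_ ?_ (by rw [p1]; simp) (by rw [p2]; simp)
    · have : (A1 : ℝ) < 0 := by exact_mod_cast hA1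
      linarith
    · have : (A2 : ℝ) < 0 := by exact_mod_cast hA2
      linarith
    · rw [neg_mul_neg]; exact_mod_cast h4
  · push Not at h4
    by_cases h0 : A1 = 0
    · have h0' := h3.1 h0
      subst h0 h0'
      exact rank2_0 S (by simpa using p1) (by simpa using p2)
    · have h0' : A2 ≠ 0 := fun h => h0 (h3.2 h)
      have hA1 : A1 ≤ -1 := by omega
      have hA2 : A2 ≤ -1 := by omega
      have l1 : -3 ≤ A1 := by nlinarith
      have l2 : -3 ≤ A2 := by nlinarith
      interval_cases A1 <;> interval_cases A2 <;>
        first | (exfalso; omega) | norm_num at p1 p2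
      · exact (rank2_3 S p2 p1).symm
      · exact (rank2_2 S p2 p1).symm
      · exact rank2_3 S p1 p2
      · exact rank2_2 S p1 p2
      · exact rank2_1 S p1 p2

lemma ascend {μ : V} (hμ : μ ∈ S.chamber) : ∀ n : ℕ, ∀ (η : V) (i : Fin m),
    Desc S Set.univ μ n η → S.coroot i η < 0 →
      ∃ n' < n, Desc S Set.univ μ n' (S.s i η) := by
  intro n
  induction n using Nat.strong_induction_on with
  | _ n IH =>
    intro η i hd hneg
    cases hd with
    | base => exact absurd (hμ i) (not_le.2 hneg)
    | @step k η' j _ h hp =>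
      by_cases hij : j = i
      · subst hij
        exact ⟨k, by omega, by rw [s_s]; exact h⟩
      · have climb : ∀ k' : ℕ, k' < k + 1 → ∀ ξ, Desc S Set.univ μ k' ξ →
            ∃ n0 k0 η₀, n0 + k0 ≤ k' ∧ Desc S Set.univ μ n0 η₀ ∧ 0 ≤ S.coroot i η₀ ∧
              0 ≤ S.coroot j η₀ ∧ Desc S {i, j} η₀ k0 ξ := by
          intro k'
          induction k' using Nat.strong_induction_on with
          | _ k' IH2 =>
            intro hk' ξ hξ
            by_cases hc : ∃ l ∈ ({i, j} : Set (Fin m)), S.coroot l ξ < 0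
            · obtain ⟨l, hl, hlneg⟩ := hc
              obtain ⟨n', hn', h'⟩ := IH k' hk' ξ l hξ hlneg
              obtain ⟨n0, k0, η₀, hle, a1, a2, a3, a4⟩ := IH2 n' hn' (by omega) _ h'
              refine ⟨n0, k0 + 1, η₀, by omega, a1, a2, a3, ?_⟩
              have := Desc.step l hl a4 (by rw [coroot_s]; linarith)
              rwa [s_s] at this
            · push Not at hc
              exact ⟨k', 0, ξ, by omega, hξ, hc i (by simp), hc j (by simp), Desc.base⟩
        obtain ⟨n0, k0, η₀, hle, a1, a2, a3, a4⟩ := climb k (by omega) η' h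
        have a5 := Desc.step j (by simp) a4 hp
        obtain ⟨k', hk', a6⟩ := rank2 S (Ne.symm hij) η₀ a2 a3 _ _ a5 i (by simp) hneg
        exact ⟨n0 + k', by omega, a1.append S a6⟩

lemma orbit_desc {μ : V} (hμ : μ ∈ S.chamber) {w : V ≃ₗ[ℝ] V} (hw : w ∈ S.W) :
    ∃ n, Desc S Set.univ μ n (w μ) := by
  have stab : ∀ i η, (∃ n, Desc S Set.univ μ n η) → ∃ n, Desc S Set.univ μ n (S.s i η) := by
    rintro i η ⟨n, h⟩
    rcases le_or_gt 0 (S.coroot i η) with h0 | h0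
    · exact ⟨_, Desc.step i (Set.mem_univ i) h h0⟩
    · obtain ⟨n', -, h'⟩ := ascend S hμ n η i h h0
      exact ⟨n', h'⟩
  have gen : ∀ η, (∃ n, Desc S Set.univ μ n η) → ∃ n, Desc S Set.univ μ n (w η) := by
    unfold GCMRealization.W at hw
    induction hw using Subgroup.closure_induction'' with
    | one => exact fun η h => h
    | mem x hx =>
      obtain ⟨i, rfl⟩ := hx
      exact stab i
    | inv_mem x hx =>
      obtain ⟨i, rfl⟩ := hx
      intro η h
      have : (S.s i)⁻¹ η = S.s i η := by
        change (S.s i).symm η = _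
        rw [LinearEquiv.symm_apply_eq, s_s]
      rw [this]
      exact stab i η h
    | mul x y _ _ hx hy => exact fun η h => hx _ (hy _ h)
  exact gen μ ⟨0, Desc.base⟩

end Paths

/-! ### Heights -/

section Heights

variable {m : ℕ} {V : Type*} [NormedAddCommGroup V] [NormedSpace ℝ V]
variable (S : GCMRealization m V)

lemma exists_functional {E : Type*} [AddCommGroup E] [Module ℝ E] {ι : Type*} {v : ι → E}
    (hv : LinearIndependent ℝ v) (c : ι → ℝ) : ∃ g : E →ₗ[ℝ] ℝ, ∀ i, g (v i) = c i := by
  obtain ⟨L, hL⟩ := LinearMap.exists_leftInverse_of_injective (Finsupp.linearCombination ℝ v)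
    (LinearMap.ker_eq_bot.2 hv)
  refine ⟨(Finsupp.linearCombination ℝ c).comp L, fun i => ?_⟩
  have h := LinearMap.congr_fun hL (Finsupp.single i 1)
  simp only [LinearMap.comp_apply, Finsupp.linearCombination_single, one_smul,
    LinearMap.id_apply] at h
  rw [LinearMap.comp_apply, h, Finsupp.linearCombination_single, one_smul]

lemma exists_weight (j : Fin m) : ∃ ω : V, ∀ i, S.coroot i ω = if i = j then 1 else 0 := by
  have := S.finDim
  obtain ⟨g, hg⟩ := exists_functional S.coroot_indep (fun i => if i = j then (1 : ℝ) else 0)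
  refine ⟨(Module.evalEquiv ℝ V).symm g, fun i => ?_⟩
  rw [← hg i]
  have := Module.apply_evalEquiv_symm_apply (R := ℝ) (M := V) (S.coroot i) g
  exact this

lemma ht_desc {ht : V →ₗ[ℝ] ℝ} (hht : ∀ i, ht (S.root i) = 1) {ω : V}
    (hω : ∀ i, ∃ z : ℤ, S.coroot i ω = z) {n : ℕ} {η : V} (h : Desc S Set.univ ω n η) :
    (∀ i, ∃ z : ℤ, S.coroot i η = z) ∧ ∃ k : ℕ, ht (ω - η) = k := by
  induction h with
  | base => exact ⟨hω, 0, by simp⟩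
  | @step k η i _ _ hp ih =>
    obtain ⟨h1, k, hk⟩ := ih
    obtain ⟨z, hz⟩ := h1 i
    constructor
    · intro l
      obtain ⟨z', hz'⟩ := h1 l
      refine ⟨z' - z * S.A l i, ?_⟩
      rw [s_apply, map_sub, map_smul, S.pairing, hz, hz', smul_eq_mul]
      push_cast
      ring
    · rw [hz] at hp
      have hz0 : 0 ≤ z := by exact_mod_cast hp
      obtain ⟨q, rfl⟩ := Int.eq_ofNat_of_zero_le hz0
      refine ⟨k + q, ?_⟩
      have : ω - S.s i η = (ω - η) + (q : ℝ) • S.root i := by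
        rw [s_apply, hz]
        simp only [Int.cast_natCast]
        abel
      rw [this, map_add, hk, map_smul, hht]
      simp

lemma fixed_of_null {ν : V} (hν : ∀ i, S.coroot i ν = 0) {w : V ≃ₗ[ℝ] V} (hw : w ∈ S.W) :
    w ν = ν := by
  have hs : ∀ i, S.s i ν = ν := fun i => by rw [s_apply, hν i]; simp
  unfold GCMRealization.W at hw
  induction hw using Subgroup.closure_induction with
  | one => rfl
  | mem x hx => obtain ⟨i, rfl⟩ := hx; exact hs i
  | inv x _ hx =>
    change x.symm ν = ν
    rw [LinearEquiv.symm_apply_eq, hx]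
  | mul x y _ _ hx hy =>
    change x (y ν) = ν
    rw [hy, hx]

lemma ht_orbit {ht : V →ₗ[ℝ] ℝ} (hht : ∀ i, ht (S.root i) = 1) (μ : V)
    {w : V ≃ₗ[ℝ] V} (hw : w ∈ S.W) :
    ht (μ - w μ) ∈ AddSubmonoid.closure (Set.range fun j => S.coroot j μ) := by
  choose ω hω using exists_weight S
  have hk : ∀ j, ∃ k : ℕ, ht (ω j - w (ω j)) = k := by
    intro j
    have hdom : ω j ∈ S.chamber := by
      intro i
      rw [hω j i]
      split_ifs <;> norm_num
    obtain ⟨n, hn⟩ := orbit_desc S hdom hw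
    refine (ht_desc S hht ?_ hn).2
    intro i
    refine ⟨if i = j then 1 else 0, ?_⟩
    rw [hω j i]
    split_ifs <;> simp
  choose k hk using hk
  set ν := μ - ∑ j, S.coroot j μ • ω j with hνd
  have hν : ∀ i, S.coroot i ν = 0 := by
    intro i
    rw [hνd, map_sub, map_sum]
    simp [hω]
  have hwν := fixed_of_null S hν hw
  have hμ : μ = ν + ∑ j, S.coroot j μ • ω j := by rw [hνd]; abel
  have : μ - w μ = ∑ j, S.coroot j μ • (ω j - w (ω j)) := by
    have h2 : w μ = ν + ∑ j, S.coroot j μ • w (ω j) := by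
      conv_lhs => rw [hμ]
      rw [map_add, hwν, map_sum]
      simp
    rw [h2]
    simp only [smul_sub, Finset.sum_sub_distrib]
    conv_lhs => rw [hμ]
    have hμ' : ν + ∑ j, S.coroot j μ • ω j = μ := hμ.symm
    rw [hμ']
    nth_rewrite 1 [← hμ']
    abel
  rw [this, map_sum]
  refine AddSubmonoid.sum_mem _ fun j _ => ?_
  rw [map_smul, hk, smul_eq_mul, mul_comm, ← nsmul_eq_mul]
  exact AddSubmonoid.nsmul_mem _ (AddSubmonoid.subset_closure (Set.mem_range_self j)) _

lemma mul_mem_closure {a t : ℝ} {T U : Set ℝ} (hT : ∀ s ∈ T, a * s ∈ U)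
    (ht : t ∈ AddSubmonoid.closure T) : a * t ∈ AddSubmonoid.closure U := by
  induction ht using AddSubmonoid.closure_induction with
  | mem x hx => exact AddSubmonoid.subset_closure (hT x hx)
  | zero => rw [mul_zero]; exact AddSubmonoid.zero_mem _
  | add x y _ _ hx hy => rw [mul_add]; exact AddSubmonoid.add_mem _ hx hy

lemma ht_hull {ht : V →ₗ[ℝ] ℝ} (hht : ∀ i, ht (S.root i) = 1) {μ : V} (hμ : μ ∈ S.chamber)
    {y : V} (hy : y ∈ S.orbitHull μ) :
    ∃ T : Set ℝ, T.Finite ∧ (∀ t ∈ T, 0 ≤ t) ∧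
      ∀ w ∈ S.W, ht (μ - w y) ∈ AddSubmonoid.closure T := by
  let K : Set V := {y | ∃ T : Set ℝ, T.Finite ∧ (∀ t ∈ T, 0 ≤ t) ∧
      ∀ w ∈ S.W, ht (μ - w y) ∈ AddSubmonoid.closure T}
  suffices h : S.orbitHull μ ⊆ K from h hy
  apply convexHull_min
  · rintro _ ⟨u, hu, rfl⟩
    refine ⟨Set.range fun j => S.coroot j μ, Set.finite_range _, ?_, ?_⟩
    · rintro _ ⟨j, rfl⟩
      exact hμ j
    · intro w hw
      exact ht_orbit S hht μ (S.W.mul_mem hw hu)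
  · rintro p ⟨T, hT, hT0, hTw⟩ q ⟨U, hU, hU0, hUw⟩ a b ha hb hab
    refine ⟨(fun t => a * t) '' T ∪ (fun t => b * t) '' U, (hT.image _).union (hU.image _),
      ?_, ?_⟩
    · rintro _ (⟨t, ht, rfl⟩ | ⟨t, ht, rfl⟩)
      · exact mul_nonneg ha (hT0 t ht)
      · exact mul_nonneg hb (hU0 t ht)
    · intro w hw
      have : ht (μ - w (a • p + b • q)) = a * ht (μ - w p) + b * ht (μ - w q) := by
        have hb' : b = 1 - a := by linarith
        subst hb'
        simp only [map_sub, map_add, map_smul, smul_eq_mul]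
        ring
      rw [this]
      apply AddSubmonoid.add_mem
      · exact mul_mem_closure (fun s hs => Or.inl ⟨s, hs, rfl⟩) (hTw w hw)
      · exact mul_mem_closure (fun s hs => Or.inr ⟨s, hs, rfl⟩) (hUw w hw)

lemma W_image_hull (μ : V) {w : V ≃ₗ[ℝ] V} (hw : w ∈ S.W) {y : V} (hy : y ∈ S.orbitHull μ) :
    w y ∈ S.orbitHull μ := by
  have h : w y ∈ (w : V →ₗ[ℝ] V) '' (convexHull ℝ (GCMRealization.orbitOf S.W μ)) := ⟨y, hy, rfl⟩
  rw [LinearMap.image_convexHull] at h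
  refine convexHull_mono ?_ h
  rintro _ ⟨_, ⟨u, hu, rfl⟩, rfl⟩
  exact ⟨w * u, S.W.mul_mem hw hu, rfl⟩

lemma s_mem_W (i : Fin m) : S.s i ∈ S.W := Subgroup.subset_closure ⟨i, rfl⟩

/-- A nonempty fundamental face is closed under ascending simple reflections. -/
lemma ascend_mem {μ : V} {F : Set V} (hF : IsFaceOf (S.orbitHull μ) F) {x : V}
    (hx : x ∈ intrinsicInterior ℝ F) (hxc : x ∈ S.chamber) {y : V} (hy : y ∈ F) (i : Fin m)
    (hi : S.coroot i y < 0) : S.s i y ∈ F := by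
  have hH : Convex ℝ (S.orbitHull μ) := convex_convexHull _ _
  obtain ⟨ε, hε, hz⟩ := ri_extend hx hy
  set z := x + ε • (x - y) with hzd
  have hzH : z ∈ S.orbitHull μ := hF.2.subset hz
  have hyH : y ∈ S.orbitHull μ := hF.2.subset hy
  have hfx := hxc i
  have hfz : S.coroot i z = (1 + ε) * S.coroot i x - ε * S.coroot i y := by
    rw [hzd, map_add, map_smul, map_sub, smul_eq_mul]; ring
  have hpos : 0 < S.coroot i z := by rw [hfz]; nlinarith
  have hle : -(ε * S.coroot i y) ≤ S.coroot i z := by rw [hfz]; nlinarith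
  have hsz := W_image_hull S μ (s_mem_W S i) hzH
  refine face_mem_left hF hε (intrinsicInterior_subset hx) (W_image_hull S μ (s_mem_W S i) hyH) ?_
  set t := -(ε * S.coroot i y) / S.coroot i z with htd
  have ht0 : 0 ≤ t := div_nonneg (by nlinarith) hpos.le
  have ht1 : t ≤ 1 := (div_le_one hpos).2 hle
  have h2 := hH hzH hsz (a := 1 - t) (b := t) (by linarith) ht0 (by ring)
  convert h2 using 1
  have e : t * S.coroot i z = -(ε * S.coroot i y) := by rw [htd]; field_simp
  rw [s_apply S i z]
  have : (1 - t) • z + t • (z - S.coroot i z • S.root i) =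
      z - (t * S.coroot i z) • S.root i := by module
  rw [this, e, hzd, s_apply]
  module

lemma inter_fund {μ : V} (hμ : μ ∈ S.chamber) {F₁ F₂ : Set V} (h₁ : S.IsFundFace μ F₁)
    (h₂ : S.IsFundFace μ F₂) : S.IsFundFace μ (F₁ ∩ F₂) := by
  have := S.finDim
  have hG := inter_face h₁.1 h₂.1
  refine ⟨hG, ?_⟩
  rcases Set.eq_empty_or_nonempty (F₁ ∩ F₂) with he | hne
  · exact Or.inl he
  right
  have hr₁ := h₁.2.resolve_left (hne.mono Set.inter_subset_left).ne_empty
  have hr₂ := h₂.2.resolve_left (hne.mono Set.inter_subset_right).ne_empty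
  obtain ⟨x₁, hx₁, hc₁⟩ := hr₁
  obtain ⟨x₂, hx₂, hc₂⟩ := hr₂
  obtain ⟨y, hy⟩ := Set.Nonempty.intrinsicInterior hG.1 hne
  have hyG := intrinsicInterior_subset hy
  obtain ⟨ht, hht⟩ := exists_functional S.root_indep (fun _ => (1 : ℝ))
  obtain ⟨T, hT, hT0, hTw⟩ := ht_hull S hht hμ (hG.2.subset hyG)
  have hpwo : (AddSubmonoid.closure T : Set ℝ).IsPWO :=
    Set.IsPWO.addSubmonoid_closure hT0 hT.isPWO
  let Q : Set ℝ := {r | ∃ w ∈ S.W, w y ∈ F₁ ∩ F₂ ∧ r = ht (μ - w y)}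
  have hQ : Q.IsWF := (hpwo.mono (by rintro _ ⟨w, hw, -, rfl⟩; exact hTw w hw)).isWF
  have hQne : Q.Nonempty := ⟨_, 1, S.W.one_mem, hyG, rfl⟩
  obtain ⟨w, hw, hwy, hmin⟩ := hQ.min_mem hQne
  refine ⟨w y, ?_, ?_⟩
  · apply ri_of_image_subset w _ hy
    rintro _ ⟨z, hz, rfl⟩
    obtain ⟨ε, hε, h⟩ := ri_extend hy hz
    refine face_mem_left hG hε hwy (W_image_hull S μ hw (hG.2.subset hz)) ?_
    have := W_image_hull S μ hw (hG.2.subset h)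
    simpa only [map_add, map_smul, map_sub] using this
  · intro i
    by_contra hneg
    push Not at hneg
    have hm : ht (μ - (S.s i * w) y) ∈ Q :=
      ⟨S.s i * w, S.W.mul_mem (s_mem_W S i) hw,
        ⟨ascend_mem S h₁.1 hx₁ hc₁ hwy.1 i hneg, ascend_mem S h₂.1 hx₂ hc₂ hwy.2 i hneg⟩, rfl⟩
    have hle := hQ.min_le hQne hm
    rw [hmin] at hle
    change _ ≤ ht (μ - S.s i (w y)) at hle
    rw [s_apply] at hle
    simp only [map_sub, map_smul, hht, smul_eq_mul, mul_one] at hle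
    linarith

lemma join_fund {μ : V} {F₁ F₂ : Set V} (h₁ : S.IsFundFace μ F₁)
    (h₂ : S.IsFundFace μ F₂) :
    ∃ F : Set V, IsLeast {F' : Set V | IsFaceOf (S.orbitHull μ) F' ∧ F₁ ∪ F₂ ⊆ F'} F ∧
      S.IsFundFace μ F := by
  have := S.finDim
  have hH : Convex ℝ (S.orbitHull μ) := convex_convexHull _ _
  rcases h₁.2 with rfl | ⟨x₁, hx₁, hc₁⟩
  · exact ⟨F₂, ⟨⟨h₂.1, by simp⟩, fun G hG => by simpa using hG.2⟩, h₂⟩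
  rcases h₂.2 with rfl | ⟨x₂, hx₂, hc₂⟩
  · exact ⟨F₁, ⟨⟨h₁.1, by simp⟩, fun G hG => by simpa using hG.2⟩, h₁⟩
  have h1F := intrinsicInterior_subset hx₁
  have h2F := intrinsicInterior_subset hx₂
  have h1H := h₁.1.2.subset h1F
  have h2H := h₂.1.2.subset h2F
  set z := (1 / 2 : ℝ) • x₁ + (1 / 2 : ℝ) • x₂ with hzd
  have hz : z ∈ S.orbitHull μ := hH h1H h2H (by norm_num) (by norm_num) (by norm_num)
  have hface := genFace_isFace hH hz
  have m1 : x₁ ∈ genFace (S.orbitHull μ) z :=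
    ⟨h1H, 1, one_pos, by convert h2H using 1; rw [hzd]; module⟩
  have m2 : x₂ ∈ genFace (S.orbitHull μ) z :=
    ⟨h2H, 1, one_pos, by convert h1H using 1; rw [hzd]; module⟩
  refine ⟨genFace (S.orbitHull μ) z, ⟨⟨hface, Set.union_subset ?_ ?_⟩, ?_⟩, hface, Or.inr ⟨z, genFace_ri hH hz, ?_⟩⟩
  · exact face_contains h₁.1.2.subset hface hx₁ m1
  · exact face_contains h₂.1.2.subset hface hx₂ m2
  · rintro G ⟨hG, hsub⟩
    exact genFace_least hG (hG.1 (hsub (Or.inl h1F)) (hsub (Or.inr h2F)) (by norm_num)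
      (by norm_num) (by norm_num))
  · intro i
    have a1 := hc₁ i
    have a2 := hc₂ i
    rw [hzd, map_add, map_smul, map_smul, smul_eq_mul, smul_eq_mul]
    linarith

end Heights

end Stmt19

open GCMRealization in
theorem statement_19 {m : ℕ} {V : Type*} [NormedAddCommGroup V] [NormedSpace ℝ V]
    (S : GCMRealization m V) (μ : V) (hμ : μ ∈ S.chamber)
    (F₁ F₂ : Set V) (h₁ : S.IsFundFace μ F₁) (h₂ : S.IsFundFace μ F₂) :
    S.IsFundFace μ (F₁ ∩ F₂) ∧
    ∃ F : Set V, IsLeast {F' : Set V | IsFaceOf (S.orbitHull μ) F' ∧ F₁ ∪ F₂ ⊆ F'} F ∧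
      S.IsFundFace μ F := by
  exact ⟨Stmt19.inter_fund S hμ h₁ h₂, Stmt19.join_fund S h₁ h₂⟩
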